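/- For a Tychonoff space X, the following are equivalent: (i) every subset of X is a CZ-set; (ii) every subset of X is F_σ in X and every closed subset of X is a CZ-set; (iii) every function f : X → ℝ is of Baire class one. -/

import Mathlib

/-- `A` is a zero set: the preimage of `{0}` under a continuous real-valued function. -/
def IsZeroSet {X : Type*} [TopologicalSpace X] (A : Set X) : Prop :=
  ∃ f : X → ℝ, Continuous f ∧ A = f ⁻¹' {0}

/-- `A` is a cozero set: the complement of a zero set. -/
def IsCozeroSet {X : Type*} [TopologicalSpace X] (A : Set X) : Prop :=
  IsZeroSet Aᶜ

/-- `A` is a `Zer_σ`-set: a countable union of zero sets. -/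
def IsZerSigma {X : Type*} [TopologicalSpace X] (A : Set X) : Prop :=
  ∃ Z : ℕ → Set X, (∀ n, IsZeroSet (Z n)) ∧ A = ⋃ n, Z n

/-- `A` is a `Coz_δ`-set: a countable intersection of cozero sets. -/
def IsCozDelta {X : Type*} [TopologicalSpace X] (A : Set X) : Prop :=
  ∃ U : ℕ → Set X, (∀ n, IsCozeroSet (U n)) ∧ A = ⋂ n, U n

/-- `A` is a `CZ`-set: simultaneously a `Zer_σ`-set and a `Coz_δ`-set. -/
def IsCZSet {X : Type*} [TopologicalSpace X] (A : Set X) : Prop :=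
  IsZerSigma A ∧ IsCozDelta A

/-- `X` is a `CZ`-space: every `Zer_σ`-set is a `Coz_δ`-set. -/
def IsCZSpace (X : Type*) [TopologicalSpace X] : Prop :=
  ∀ A : Set X, IsZerSigma A → IsCozDelta A

/-- `A` is an `F_σ`-set: a countable union of closed sets. -/
def IsFSigma {X : Type*} [TopologicalSpace X] (A : Set X) : Prop :=
  ∃ F : ℕ → Set X, (∀ n, IsClosed (F n)) ∧ A = ⋃ n, F n

/-- `f` is of Baire class one: a pointwise limit of a sequence of continuous functions. -/
def IsBaireOne {X : Type*} [TopologicalSpace X] (f : X → ℝ) : Prop :=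
  ∃ g : ℕ → X → ℝ, (∀ n, Continuous (g n)) ∧
    ∀ x, Filter.Tendsto (fun n => g n x) Filter.atTop (nhds (f x))

theorem qf_iInter_zero {X : Type*} [TopologicalSpace X] (Z : ℕ → Set X)
    (h : ∀ n, IsZeroSet (Z n)) : IsZeroSet (⋂ n, Z n) := by
  choose f hf hZ using h
  have hs : Summable (fun n : ℕ => (1 / 2 : ℝ) ^ n) := summable_geometric_two
  have hb : ∀ n x, ‖min |f n x| ((1 / 2 : ℝ) ^ n)‖ ≤ (1 / 2 : ℝ) ^ n := by
    intro n x
    rw [Real.norm_of_nonneg (by positivity)]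
    exact min_le_right _ _
  refine ⟨fun x => ∑' n, min |f n x| ((1 / 2 : ℝ) ^ n), ?_, ?_⟩
  · exact continuous_tsum (fun n => ((hf n).abs.min continuous_const)) hs hb
  · ext x
    have hsx : Summable (fun n => min |f n x| ((1 / 2 : ℝ) ^ n)) :=
      Summable.of_norm_bounded hs (fun n => hb n x)
    have h0 : ∀ n, 0 ≤ min |f n x| ((1 / 2 : ℝ) ^ n) := fun n => by positivity
    simp only [Set.mem_iInter, Set.mem_preimage, Set.mem_singleton_iff]
    rw [← hsx.hasSum_iff, hasSum_zero_iff_of_nonneg h0, funext_iff]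
    refine forall_congr' fun n => ?_
    rw [hZ n]
    simp only [Set.mem_preimage, Set.mem_singleton_iff, Pi.zero_apply]
    constructor
    · intro h; simp [h]
    · intro h
      rcases min_choice |f n x| ((1 / 2 : ℝ) ^ n) with h1 | h1
      · rw [h1] at h; exact abs_eq_zero.1 h
      · rw [h1] at h; exact absurd h (by positivity)

theorem qf_zero_le {X : Type*} [TopologicalSpace X] (g : X → ℝ) (hg : Continuous g) (c : ℝ) :
    IsZeroSet {x | c ≤ g x} := by
  refine ⟨fun x => max (c - g x) 0, by fun_prop, ?_⟩
  ext x
  simp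

theorem qf_cz_of_sigma {X : Type*} [TopologicalSpace X]
    (h : ∀ A : Set X, IsZerSigma A) (A : Set X) : IsCZSet A := by
  refine ⟨h A, ?_⟩
  obtain ⟨Z, hZ, hA⟩ := h Aᶜ
  refine ⟨fun n => (Z n)ᶜ, fun n => ?_, ?_⟩
  · unfold IsCozeroSet; rw [compl_compl]; exact hZ n
  · rw [← Set.compl_iUnion, ← hA, compl_compl]

theorem qf_sigma_iUnion {X : Type*} [TopologicalSpace X] (F : ℕ → Set X)
    (h : ∀ n, IsZerSigma (F n)) : IsZerSigma (⋃ n, F n) := by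
  choose Z hZ hF using h
  refine ⟨fun k => Z k.unpair.1 k.unpair.2, fun k => hZ _ _, ?_⟩
  rw [Set.iUnion_unpair (fun i j => Z i j)]
  exact Set.iUnion_congr hF

theorem qf_indicator {X : Type*} [TopologicalSpace X]
    (h : ∀ A : Set X, IsZerSigma A) (A : Set X) :
    ∃ g : ℕ → X → ℝ, (∀ n, Continuous (g n)) ∧ (∀ n x, |g n x| ≤ 1) ∧
      ∀ x, Filter.Tendsto (fun n => g n x) Filter.atTop (nhds (A.indicator 1 x)) := by
  obtain ⟨Z, hZ, hA⟩ := h A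
  obtain ⟨W, hW, hB⟩ := h Aᶜ
  choose z hz hZ using hZ
  choose w hw hW using hW
  have mA : ∀ x, x ∈ A ↔ ∃ n, z n x = 0 := by
    intro x; rw [hA]; simp [hZ]
  have mB : ∀ x, x ∉ A ↔ ∃ n, w n x = 0 := by
    intro x; rw [← Set.mem_compl_iff, hB]; simp [hW]
  have p0 : ∀ (u : ℕ → X → ℝ) n x, 0 ≤ ∏ i ∈ Finset.range n, |u i x| :=
    fun u n x => Finset.prod_nonneg fun i _ => abs_nonneg _
  have pz : ∀ (u : ℕ → X → ℝ) n x, (∏ i ∈ Finset.range n, |u i x|) = 0 → ∃ i, u i x = 0 := by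
    intro u n x hh
    obtain ⟨i, -, hi⟩ := Finset.prod_eq_zero_iff.1 hh
    exact ⟨i, abs_eq_zero.1 hi⟩
  have ev : ∀ (u : ℕ → X → ℝ) x, (∃ i, u i x = 0) →
      ∀ᶠ n in Filter.atTop, (∏ i ∈ Finset.range n, |u i x|) = 0 := by
    rintro u x ⟨i, hi⟩
    filter_upwards [Filter.eventually_gt_atTop i] with n hn
    exact Finset.prod_eq_zero (Finset.mem_range.2 hn) (by simp [hi])
  have pos : ∀ n x, (∏ i ∈ Finset.range n, |w i x|) + (∏ i ∈ Finset.range n, |z i x|) ≠ 0 := by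
    intro n x hh
    have h1 : (∏ i ∈ Finset.range n, |w i x|) = 0 := by linarith [p0 w n x, p0 z n x]
    have h2 : (∏ i ∈ Finset.range n, |z i x|) = 0 := by linarith [p0 w n x, p0 z n x]
    exact (mB x).2 (pz w n x h1) ((mA x).2 (pz z n x h2))
  refine ⟨fun n x => (∏ i ∈ Finset.range n, |w i x|) /
    ((∏ i ∈ Finset.range n, |w i x|) + (∏ i ∈ Finset.range n, |z i x|)), ?_, ?_, ?_⟩
  · intro n
    refine Continuous.div ?_ ?_ (pos n)
    · exact continuous_finsetProd _ fun i _ => (hw i).abs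
    · exact (continuous_finsetProd _ fun i _ => (hw i).abs).add
        (continuous_finsetProd _ fun i _ => (hz i).abs)
  · intro n x
    rw [abs_of_nonneg (div_nonneg (p0 w n x) (add_nonneg (p0 w n x) (p0 z n x)))]
    exact div_le_one_of_le₀ (by linarith [p0 z n x]) (add_nonneg (p0 w n x) (p0 z n x))
  · intro x
    refine tendsto_const_nhds.congr' ?_
    by_cases hx : x ∈ A
    · filter_upwards [ev z x ((mA x).1 hx)] with n hn
      have := pos n x
      rw [hn, add_zero] at this ⊢
      rw [div_self this]
      simp [hx]
    · filter_upwards [ev w x ((mB x).1 hx)] with n hn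
      rw [hn, zero_div]
      simp [hx]

theorem qf_unit {X : Type*} [TopologicalSpace X]
    (h : ∀ A : Set X, IsZerSigma A) (f : X → ℝ) (hf : ∀ x, f x ∈ Set.Ico (0:ℝ) 1) :
    IsBaireOne f := by
  let A : ℕ → Set X := fun k => {x | Real.digits (f x) 2 k = 1}
  have hfx : ∀ x, f x = ∑' k, (A k).indicator 1 x * (1 / 2 : ℝ) ^ (k + 1) := by
    intro x
    rw [← Real.ofDigits_digits (b := 2) (by norm_num) (hf x)]
    unfold Real.ofDigits Real.ofDigitsTerm
    refine tsum_congr fun k => ?_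
    by_cases hk : Real.digits (f x) 2 k = 1
    · have : x ∈ A k := hk
      rw [Set.indicator_of_mem this, hk]; simp
    · have : x ∉ A k := hk
      have h0 : Real.digits (f x) 2 k = 0 := by omega
      rw [Set.indicator_of_notMem this, h0]; simp
  choose g hg hg1 hgt using fun k => qf_indicator h (A k)
  have hs : Summable (fun n : ℕ => (1 / 2 : ℝ) ^ (n + 1)) :=
    (summable_nat_add_iff 1).2 summable_geometric_two
  have hb : ∀ n k x, ‖g k n x * (1 / 2 : ℝ) ^ (k + 1)‖ ≤ (1 / 2 : ℝ) ^ (k + 1) := by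
    intro n k x
    rw [norm_mul, Real.norm_of_nonneg (r := (1 / 2 : ℝ) ^ (k + 1)) (by positivity)]
    exact mul_le_of_le_one_left (by positivity) (hg1 k n x)
  refine ⟨fun n x => ∑' k, g k n x * (1 / 2 : ℝ) ^ (k + 1), ?_, ?_⟩
  · intro n
    exact continuous_tsum (fun k => (hg k n).mul continuous_const) hs (hb n)
  · intro x
    rw [hfx x]
    exact tendsto_tsum_of_dominated_convergence hs (fun k => (hgt k x).mul_const _)
      (Filter.Eventually.of_forall fun n k => hb n k x)

theorem qf_baire {X : Type*} [TopologicalSpace X]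
    (h : ∀ A : Set X, IsZerSigma A) (f : X → ℝ) : IsBaireOne f := by
  have hpi := Real.pi_pos
  have hy : ∀ x, (Real.arctan (f x) + Real.pi / 2) / Real.pi ∈ Set.Ioo (0:ℝ) 1 := by
    intro x
    have h1 := Real.neg_pi_div_two_lt_arctan (f x)
    have h2 := Real.arctan_lt_pi_div_two (f x)
    exact ⟨div_pos (by linarith) hpi, by rw [div_lt_one hpi]; linarith⟩
  obtain ⟨g, hg, hgt⟩ := qf_unit h (fun x => (Real.arctan (f x) + Real.pi / 2) / Real.pi)
    (fun x => ⟨(hy x).1.le, (hy x).2⟩)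
  let e : ℕ → ℝ := fun n => 1 / ((n : ℝ) + 1) / 2
  have e0 : ∀ n, 0 < e n := fun n => by positivity
  have e1 : ∀ n, e n ≤ 1 / 2 := fun n => by
    have : 1 / ((n : ℝ) + 1) ≤ 1 := div_le_one_of_le₀ (by linarith [n.cast_nonneg (α := ℝ)]) (by positivity)
    show 1 / ((n : ℝ) + 1) / 2 ≤ 1 / 2
    linarith
  have et : Filter.Tendsto e Filter.atTop (nhds 0) := by
    have := (tendsto_one_div_add_atTop_nhds_zero_nat (𝕜 := ℝ)).div_const 2
    rwa [zero_div] at this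
  let c : ℕ → X → ℝ := fun n x => max (e n) (min (1 - e n) (g n x))
  have hc : ∀ n, Continuous (c n) := fun n => by
    have := hg n
    fun_prop
  have hcm : ∀ n x, Real.pi * c n x - Real.pi / 2 ∈ Set.Ioo (-(Real.pi / 2)) (Real.pi / 2) := by
    intro n x
    have h1 : 0 < c n x := lt_of_lt_of_le (e0 n) (le_max_left _ _)
    have h2 : c n x < 1 := max_lt (by linarith [e1 n])
      (lt_of_le_of_lt (min_le_left _ _) (by linarith [e0 n]))
    constructor <;> nlinarith
  refine ⟨fun n x => Real.tan (Real.pi * c n x - Real.pi / 2), ?_, ?_⟩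
  · intro n
    have := hc n
    exact Real.continuousOn_tan_Ioo.comp_continuous (by fun_prop) (hcm n)
  · intro x
    have hct : Filter.Tendsto (fun n => c n x) Filter.atTop
        (nhds ((Real.arctan (f x) + Real.pi / 2) / Real.pi)) := by
      have := et.max ((tendsto_const_nhds (x := (1:ℝ)).sub et).min (hgt x))
      rwa [sub_zero, min_eq_right (hy x).2.le, max_eq_right (hy x).1.le] at this
    have h3 := (hct.const_mul Real.pi).sub_const (Real.pi / 2)
    rw [mul_div_cancel₀ _ hpi.ne', add_sub_cancel_right] at h3
    have h4 : ContinuousAt Real.tan (Real.arctan (f x)) :=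
      Real.continuousAt_tan.2 (Real.cos_arctan_pos _).ne'
    have h5 := h4.tendsto.comp h3
    rwa [Real.tan_arctan] at h5

theorem qf_sigma_of_baire {X : Type*} [TopologicalSpace X]
    (h : ∀ f : X → ℝ, IsBaireOne f) (A : Set X) : IsZerSigma A := by
  obtain ⟨g, hg, ht⟩ := h (A.indicator 1)
  refine ⟨fun N => ⋂ n, {x | (1 / 2 : ℝ) ≤ g (N + n) x},
    fun N => qf_iInter_zero _ fun n => qf_zero_le _ (hg _) _, ?_⟩
  ext x
  simp only [Set.mem_iUnion, Set.mem_iInter, Set.mem_ofPred_eq]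
  constructor
  · intro hx
    have h1 := ht x
    rw [Set.indicator_of_mem hx] at h1
    obtain ⟨N, hN⟩ := Filter.eventually_atTop.1
      (h1.eventually_const_le (show (1 / 2 : ℝ) < (1 : X → ℝ) x by norm_num))
    exact ⟨N, fun n => hN _ (by omega)⟩
  · rintro ⟨N, hN⟩
    by_contra hx
    have h1 := ht x
    rw [Set.indicator_of_notMem hx] at h1
    have : (1 / 2 : ℝ) ≤ 0 := ge_of_tendsto h1 (Filter.eventually_atTop.2 ⟨N, fun n hn => by
      obtain ⟨k, rfl⟩ := Nat.exists_eq_add_of_le hn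
      exact hN k⟩)
    norm_num at this

/-- For a Tychonoff space `X` the following are equivalent: (i) every subset is a `CZ`-set;
(ii) every subset is `F_σ` and every closed subset is a `CZ`-set; (iii) every real-valued
function on `X` is Baire-one. -/
theorem qf_space_characterization {X : Type*} [TopologicalSpace X] [T35Space X] :
    List.TFAE
      [∀ A : Set X, IsCZSet A,
       (∀ A : Set X, IsFSigma A) ∧ (∀ A : Set X, IsClosed A → IsCZSet A),
       ∀ f : X → ℝ, IsBaireOne f] := by
  tfae_have 1 → 2 := by
    intro h
    refine ⟨fun A => ?_, fun A _ => h A⟩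
    obtain ⟨Z, hZ, hA⟩ := (h A).1
    refine ⟨Z, fun n => ?_, hA⟩
    obtain ⟨f, hf, he⟩ := hZ n
    rw [he]
    exact isClosed_singleton.preimage hf
  tfae_have 2 → 1 := by
    rintro ⟨h1, h2⟩
    refine qf_cz_of_sigma fun A => ?_
    obtain ⟨F, hF, rfl⟩ := h1 A
    exact qf_sigma_iUnion F fun n => (h2 _ (hF n)).1
  tfae_have 1 → 3 := fun h f => qf_baire (fun A => (h A).1) f
  tfae_have 3 → 1 := fun h => qf_cz_of_sigma (qf_sigma_of_baire h)
  tfae_finish
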